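/- arXiv:1706.07399 — 6 statements merged into one kernel-verified Lean document; each statement's English description precedes it below -/
import Mathlib

section
/- Let x ∈ G and let y = g(x) be the unique point of G' with ‖x − y‖_∞ ≤ α. Then for every p ∈ ℝ^d with ‖p − x‖_∞ ≤ α/2, the point y is a nearest point of G' to p in the Euclidean norm. Consequently, if x is a nearest point of G to p and p has a unique nearest point a'(p) in G' (equivalently, ‖p − a'(p)‖_∞ < α), then a'(p) = g(x); i.e., the nearest-point map to G' composed with any section of the nearest-point map to G agrees with g on G. -/
open scoped BigOperators

/-- The Euclidean distance on `Fin d → ℝ`. -/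
noncomputable def euclDist {d : ℕ} (p q : Fin d → ℝ) : ℝ :=
  Real.sqrt (∑ i, (p i - q i) ^ 2)

/-- The scaled shifted integer lattice `G = {t + α·z : z ∈ ℤ^d}`. -/
def grid (d : ℕ) (α : ℝ) (t : Fin d → ℝ) : Set (Fin d → ℝ) :=
  {x | ∀ i, ∃ z : ℤ, x i = t i + α * z}

/-- The shifted lattice at the doubled scale:
`G' = {t + (α/2)·ε + 2α·z : z ∈ ℤ^d}`. -/
def grid' (d : ℕ) (α : ℝ) (t ε : Fin d → ℝ) : Set (Fin d → ℝ) :=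
  {x | ∀ i, ∃ z : ℤ, x i = t i + α / 2 * ε i + 2 * α * z}

lemma euclDist_le_of_abs_le {d : ℕ} {p q r : Fin d → ℝ}
    (h : ∀ i, |p i - q i| ≤ |p i - r i|) : euclDist p q ≤ euclDist p r :=
  Real.sqrt_le_sqrt (Finset.sum_le_sum fun i _ => sq_le_sq.mpr (h i))

/-- Comparing the distance to a point with the distance to the same point with one coordinate
changed only involves that coordinate. -/
lemma abs_le_of_euclDist_le_update {d : ℕ} {p x : Fin d → ℝ} {i : Fin d} {c : ℝ}
    (h : euclDist p x ≤ euclDist p (Function.update x i c)) : |p i - x i| ≤ |p i - c| := by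
  unfold euclDist at h
  rw [Real.sqrt_le_sqrt_iff (Finset.sum_nonneg fun j _ => sq_nonneg _),
    ← Finset.add_sum_erase _ _ (Finset.mem_univ i),
    ← Finset.add_sum_erase _ (fun j => (p j - Function.update x i c j) ^ 2)
      (Finset.mem_univ i)] at h
  have hrest : ∑ j ∈ Finset.univ.erase i, (p j - Function.update x i c j) ^ 2 =
      ∑ j ∈ Finset.univ.erase i, (p j - x j) ^ 2 :=
    Finset.sum_congr rfl fun j hj => by
      rw [Function.update_of_ne (Finset.ne_of_mem_erase hj)]
  rw [hrest, Function.update_self] at h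
  exact sq_le_sq.mp (by linarith)

lemma update_add_mul_mem_grid {d : ℕ} {α : ℝ} {t x : Fin d → ℝ} (hx : x ∈ grid d α t)
    (i : Fin d) (n : ℤ) : Function.update x i (x i + α * n) ∈ grid d α t := by
  intro j
  obtain ⟨z, hz⟩ := hx j
  rcases eq_or_ne j i with rfl | hj
  · exact ⟨z + n, by rw [Function.update_self, hz]; push_cast; ring⟩
  · exact ⟨z, by rw [Function.update_of_ne hj, hz]⟩

lemma abs_sub_le_half_of_nearest_grid {d : ℕ} {α : ℝ} (hα : 0 < α) {t x p : Fin d → ℝ}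
    (hx : x ∈ grid d α t) (h : ∀ q ∈ grid d α t, euclDist p x ≤ euclDist p q) (i : Fin d) :
    |p i - x i| ≤ α / 2 := by
  have h₁ := sq_le_sq.mpr
    (abs_le_of_euclDist_le_update (h _ (update_add_mul_mem_grid hx i 1)))
  have h₂ := sq_le_sq.mpr
    (abs_le_of_euclDist_le_update (h _ (update_add_mul_mem_grid hx i (-1))))
  push_cast at h₁ h₂
  rw [abs_le]
  constructor <;> nlinarith

/-- A coordinate of a point of `G` and one of `G'` differ by an odd multiple of `α / 2`, so they
differ by at most `α / 2` once they differ by at most `α`. -/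
lemma abs_sub_le_half_of_mem_grid {d : ℕ} {α : ℝ} (hα : 0 < α) {t ε x y : Fin d → ℝ}
    (hε : ∀ i, ε i = 1 ∨ ε i = -1) (hx : x ∈ grid d α t) (hy : y ∈ grid' d α t ε)
    (hxy : ‖x - y‖ ≤ α) (i : Fin d) : |x i - y i| ≤ α / 2 := by
  obtain ⟨k, hk⟩ := hx i
  obtain ⟨m, hm⟩ := hy i
  have hi : |x i - y i| ≤ α := (norm_le_pi_norm (x - y) i).trans hxy
  obtain ⟨n, hn⟩ : ∃ n : ℤ, x i - y i = α * (n + 1 / 2) := by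
    rcases hε i with h | h
    · exact ⟨k - 2 * m - 1, by rw [hk, hm, h]; push_cast; ring⟩
    · exact ⟨k - 2 * m, by rw [hk, hm, h]; push_cast; ring⟩
  rw [hn, abs_le] at hi
  have hlo : (-2 : ℝ) < n := by nlinarith [hi.1]
  have hhi : (n : ℝ) < 1 := by nlinarith [hi.2]
  have hlo' : -2 < n := by exact_mod_cast hlo
  have hhi' : n < 1 := by exact_mod_cast hhi
  obtain rfl | rfl : n = -1 ∨ n = 0 := by omega
  all_goals
    rw [hn, abs_le]
    push_cast
    constructor <;> linarith

lemma exists_sub_eq_of_mem_grid' {d : ℕ} {α : ℝ} {t ε y q : Fin d → ℝ}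
    (hy : y ∈ grid' d α t ε) (hq : q ∈ grid' d α t ε) (i : Fin d) :
    ∃ n : ℤ, q i - y i = 2 * α * n := by
  obtain ⟨m, hm⟩ := hy i
  obtain ⟨k, hk⟩ := hq i
  exact ⟨k - m, by rw [hk, hm]; push_cast; ring⟩

/-- Two points of `G'` with coordinates at distances at most `α` and less than `α` from a common
number have the same coordinate. -/
lemma eq_of_mem_grid'_of_abs_lt {d : ℕ} {α : ℝ} (hα : 0 < α) {t ε y q : Fin d → ℝ}
    (hy : y ∈ grid' d α t ε) (hq : q ∈ grid' d α t ε) {i : Fin d} {c : ℝ}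
    (hcy : |c - y i| ≤ α) (hcq : |c - q i| < α) : q i = y i := by
  obtain ⟨n, hn⟩ := exists_sub_eq_of_mem_grid' hy hq i
  rw [abs_le] at hcy
  rw [abs_lt] at hcq
  have hlo : (-1 : ℝ) < n := by nlinarith
  have hhi : (n : ℝ) < 1 := by nlinarith
  have hlo' : -1 < n := by exact_mod_cast hlo
  have hhi' : n < 1 := by exact_mod_cast hhi
  obtain rfl : n = 0 := by omega
  push_cast at hn
  linarith

/-- Let `x ∈ G` and `y = g(x) ∈ G'` be the (unique) point with
`‖x − y‖_∞ ≤ α` (the sup-norm `‖·‖` on `Fin d → ℝ` is the `L∞`-norm).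
Then (1) for every `p` with `‖p − x‖_∞ ≤ α/2`, `y` is a nearest point of
`G'` to `p` in the Euclidean norm; and (2) if `x` is a Euclidean nearest
point of `G` to `p` and `a'` is a point of `G'` with `‖p − a'‖_∞ < α`
(i.e. `a'` is the unique nearest point of `G'` to `p`), then `a' = y`. -/
theorem stmt3 (d : ℕ) (hd : 1 ≤ d) (α : ℝ) (hα : 0 < α) (t ε : Fin d → ℝ)
    (hε : ∀ i, ε i = 1 ∨ ε i = -1) (x y : Fin d → ℝ)
    (hx : x ∈ grid d α t) (hy : y ∈ grid' d α t ε) (hxy : ‖x - y‖ ≤ α) :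
    (∀ p : Fin d → ℝ, ‖p - x‖ ≤ α / 2 →
        ∀ q ∈ grid' d α t ε, euclDist p y ≤ euclDist p q) ∧
    (∀ p a' : Fin d → ℝ, (∀ q ∈ grid d α t, euclDist p x ≤ euclDist p q) →
        a' ∈ grid' d α t ε → ‖p - a'‖ < α → a' = y) := by
  have hpy : ∀ p : Fin d → ℝ, (∀ i, |p i - x i| ≤ α / 2) → ∀ i, |p i - y i| ≤ α := fun p hp i =>
    (abs_sub_le _ (x i) _).trans
      (by linarith [hp i, abs_sub_le_half_of_mem_grid hα hε hx hy hxy i])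
  constructor
  · intro p hp q hq
    refine euclDist_le_of_abs_le fun i => ?_
    have hi := hpy p (fun i => (norm_le_pi_norm (p - x) i).trans hp) i
    rcases lt_or_ge |p i - q i| α with h | h
    · rw [eq_of_mem_grid'_of_abs_lt hα hy hq hi h]
    · exact hi.trans h
  · intro p a' hp ha' hpa'
    funext i
    exact eq_of_mem_grid'_of_abs_lt hα hy ha'
      (hpy p (abs_sub_le_half_of_nearest_grid hα hx hp) i)
      ((norm_le_pi_norm (p - a') i).trans_lt hpa')
end

section
/- Let Q ⊆ ℝ^d be a set whose L∞-diameter is at most α, i.e., ‖p − q‖_∞ ≤ α for all p, q ∈ Q. Then the rounded points a(Q) are all contained in a single face of the cubical complex on G: there exists w ∈ G such that for every p ∈ Q and every coordinate i, a(p)_i ∈ {w_i, w_i + α}. In particular, for any simplex σ = (p_0,…,p_k) of the L∞-Rips complex of a point set at scale α, the active vertices a(p_0),…,a(p_k) lie in a common face of the cubical complex on G. -/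
/-- The coordinatewise rounding map to the lattice `G`:
`a(p)_i = t_i + α·⌊(p_i − t_i)/α + 1/2⌋`. -/
noncomputable def roundPt (d : ℕ) (α : ℝ) (t : Fin d → ℝ)
    (p : Fin d → ℝ) : Fin d → ℝ :=
  fun i => t i + α * ⌊(p i - t i) / α + 1 / 2⌋

/-- Integers that pairwise differ by at most one take at most two consecutive values. -/
theorem exists_forall_eq_or_eq_add_one {ι : Type*} (s : Set ι) (f : ι → ℤ)
    (hf : ∀ p ∈ s, ∀ q ∈ s, f p ≤ f q + 1) :
    ∃ m : ℤ, ∀ p ∈ s, f p = m ∨ f p = m + 1 := by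
  obtain rfl | ⟨a, ha⟩ := s.eq_empty_or_nonempty
  · exact ⟨0, by simp⟩
  by_cases h : ∃ b ∈ s, f b < f a
  · obtain ⟨b, hb, hba⟩ := h
    refine ⟨f b, fun p hp => ?_⟩
    have h₁ := hf p hp b hb
    have h₂ := hf a ha p hp
    lia
  · push Not at h
    refine ⟨f a, fun p hp => ?_⟩
    have h₁ := hf p hp a ha
    have h₂ := h p hp
    lia

/-- The lattice indices of two reals at distance at most `α` differ by at most one. -/
theorem floor_div_add_half_le {α x y : ℝ} (hα : 0 < α) (s : ℝ) (h : x - y ≤ α) :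
    ⌊(x - s) / α + 1 / 2⌋ ≤ ⌊(y - s) / α + 1 / 2⌋ + 1 := by
  rw [← Int.floor_add_one]
  refine Int.floor_le_floor ?_
  have h₁ : (x - s) / α ≤ (y - s) / α + 1 := by
    rw [div_add_one hα.ne']
    gcongr
    linarith
  linarith

/-- If `Q ⊆ ℝ^d` has `L∞`-diameter at most `α` (the sup-norm `‖·‖` on
`Fin d → ℝ` is the `L∞`-norm), then the rounded points `a(Q)` all lie in a
single face of the cubical complex on `G`: there is `w ∈ G` with
`a(p)_i ∈ {w_i, w_i + α}` for all `p ∈ Q` and all coordinates `i`. -/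
theorem stmt4 (d : ℕ) (hd : 1 ≤ d) (α : ℝ) (hα : 0 < α) (t : Fin d → ℝ)
    (Q : Set (Fin d → ℝ)) (hQ : ∀ p ∈ Q, ∀ q ∈ Q, ‖p - q‖ ≤ α) :
    ∃ w ∈ grid d α t, ∀ p ∈ Q, ∀ i,
      roundPt d α t p i = w i ∨ roundPt d α t p i = w i + α := by
  have key : ∀ i, ∃ m : ℤ, ∀ p ∈ Q, ⌊(p i - t i) / α + 1 / 2⌋ = m ∨
      ⌊(p i - t i) / α + 1 / 2⌋ = m + 1 := fun i =>
    exists_forall_eq_or_eq_add_one Q _ fun p hp q hq =>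
      floor_div_add_half_le hα (t i) <|
        (le_abs_self _).trans ((norm_le_pi_norm (p - q) i).trans (hQ p hp q hq))
  choose m hm using key
  refine ⟨fun i => t i + α * m i, fun i => ⟨m i, rfl⟩, fun p hp i => ?_⟩
  refine (hm i p hp).imp (fun h => ?_) (fun h => ?_)
  · simp only [roundPt, h]
  · simp only [roundPt, h]
    push_cast
    ring
end

section
/- Let w ∈ G, δ ∈ {0,1}^d, and let F = vert(w,δ) = {x ∈ G : ∀i, x_i = w_i or x_i = w_i + δ_i·α} be the vertex set of the face (w,δ) of the cubical complex on G. Then there exist w' ∈ G' and δ' ∈ {0,1}^d such that the image g(F) equals vert'(w',δ') = {y ∈ G' : ∀i, y_i = w'_i or y_i = w'_i + δ'_i·2α}; that is, the vertices of a face of the cubical complex on G map under g onto the vertices of a face of the cubical complex on G'. Moreover, every free direction of the image face is free for the original face: δ'_i = 1 implies δ_i = 1. -/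
/-- The vertex set of the face `(w, δ)` of the cubical complex on `G`. -/
def vert (d : ℕ) (α : ℝ) (t : Fin d → ℝ) (w δ : Fin d → ℝ) :
    Set (Fin d → ℝ) :=
  {x | x ∈ grid d α t ∧ ∀ i, x i = w i ∨ x i = w i + δ i * α}

/-- The vertex set of the face `(w', δ')` of the cubical complex on `G'`
(spacing `2α`). -/
def vert' (d : ℕ) (α : ℝ) (t ε : Fin d → ℝ) (w' δ' : Fin d → ℝ) :
    Set (Fin d → ℝ) :=
  {y | y ∈ grid' d α t ε ∧ ∀ i, y i = w' i ∨ y i = w' i + δ' i * (2 * α)}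

/-- In one coordinate, with `ε = 1 - 2s` for `s ∈ {0,1}`, the point of `α/2·ε + 2αℤ` within
distance `α` of `α·m` has index `⌊(m + s)/2⌋`. -/
theorem index_eq_ediv_of_abs_le {α t ε : ℝ} (hα : 0 < α) {s : ℤ}
    (hs : (s = 0 ∧ ε = 1) ∨ (s = 1 ∧ ε = -1)) {m k : ℤ}
    (h : |(t + α * m) - (t + α / 2 * ε + 2 * α * k)| ≤ α) : k = (m + s) / 2 := by
  have he : (t + α * m) - (t + α / 2 * ε + 2 * α * k) = α * (m - ε / 2 - 2 * k) := by ring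
  rw [he, abs_mul, abs_of_pos hα, mul_le_iff_le_one_right hα, abs_le] at h
  obtain ⟨h₁, h₂⟩ := h
  rcases hs with ⟨rfl, rfl⟩ | ⟨rfl, rfl⟩
  · have h₃ : (-1 : ℤ) < m - 2 * k := by
      have : ((-1 : ℤ) : ℝ) < ((m - 2 * k : ℤ) : ℝ) := by push_cast; linarith
      exact_mod_cast this
    have h₄ : m - 2 * k < (2 : ℤ) := by
      have : ((m - 2 * k : ℤ) : ℝ) < ((2 : ℤ) : ℝ) := by push_cast; linarith
      exact_mod_cast this
    omega
  · have h₃ : (-2 : ℤ) < m - 2 * k := by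
      have : ((-2 : ℤ) : ℝ) < ((m - 2 * k : ℤ) : ℝ) := by push_cast; linarith
      exact_mod_cast this
    have h₄ : m - 2 * k < (1 : ℤ) := by
      have : ((m - 2 * k : ℤ) : ℝ) < ((1 : ℤ) : ℝ) := by push_cast; linarith
      exact_mod_cast this
    omega

/-- The image under the grid map `g : G → G'` (sending `x ∈ G` to the
unique `y ∈ G'` with `‖x − y‖_∞ ≤ α`; the sup-norm `‖·‖` on `Fin d → ℝ` is
the `L∞`-norm) of the vertex set of a face `(w,δ)` of the cubical complex
on `G` is the vertex set of a face `(w',δ')` of the cubical complex on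
`G'`; moreover every free direction of the image face is free for the
original face: `δ'_i = 1 → δ_i = 1`. -/
theorem stmt7 (d : ℕ) (hd : 1 ≤ d) (α : ℝ) (hα : 0 < α) (t ε : Fin d → ℝ)
    (hε : ∀ i, ε i = 1 ∨ ε i = -1)
    (g : (Fin d → ℝ) → (Fin d → ℝ))
    (hg : ∀ x ∈ grid d α t, g x ∈ grid' d α t ε ∧ ‖x - g x‖ ≤ α)
    (w : Fin d → ℝ) (hw : w ∈ grid d α t)
    (δ : Fin d → ℝ) (hδ : ∀ i, δ i = 0 ∨ δ i = 1) :
    ∃ w' δ' : Fin d → ℝ, w' ∈ grid' d α t ε ∧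
      (∀ i, δ' i = 0 ∨ δ' i = 1) ∧
      g '' vert d α t w δ = vert' d α t ε w' δ' ∧
      (∀ i, δ' i = 1 → δ i = 1) := by
  have hs : ∀ i, ∃ s : ℤ, (s = 0 ∧ ε i = 1) ∨ (s = 1 ∧ ε i = -1) := fun i =>
    (hε i).elim (fun h => ⟨0, .inl ⟨rfl, h⟩⟩) (fun h => ⟨1, .inr ⟨rfl, h⟩⟩)
  have he : ∀ i, ∃ e : ℤ, (e = 0 ∨ e = 1) ∧ δ i = e := fun i =>
    (hδ i).elim (fun h => ⟨0, .inl rfl, by simpa using h⟩)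
      (fun h => ⟨1, .inr rfl, by simpa using h⟩)
  choose s hs using hs
  choose e he hδe using he
  choose n hn using hw
  have hmem : ∀ m : Fin d → ℤ, (fun i => t i + α * (m i : ℝ)) ∈ grid d α t :=
    fun m i => ⟨m i, rfl⟩
  have hgm : ∀ m : Fin d → ℤ, g (fun i => t i + α * (m i : ℝ)) =
      fun i => t i + α / 2 * ε i + 2 * α * (((m i + s i) / 2 : ℤ) : ℝ) := by
    intro m
    obtain ⟨h₁, h₂⟩ := hg _ (hmem m)
    funext i
    obtain ⟨k, hk⟩ := h₁ i
    have h₃ := (norm_le_pi_norm _ i).trans h₂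
    rw [Pi.sub_apply, hk, Real.norm_eq_abs] at h₃
    rw [hk, index_eq_ediv_of_abs_le hα (hs i) h₃]
  refine ⟨fun i => t i + α / 2 * ε i + 2 * α * (((n i + s i) / 2 : ℤ) : ℝ),
    fun i => (((n i + e i + s i) / 2 - (n i + s i) / 2 : ℤ) : ℝ),
    fun i => ⟨_, rfl⟩, fun i => ?_, ?_, fun i hi => ?_⟩
  · have : (n i + e i + s i) / 2 - (n i + s i) / 2 = 0 ∨
        (n i + e i + s i) / 2 - (n i + s i) / 2 = 1 := by
      rcases he i with h | h <;> omega
    beta_reduce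
    exact_mod_cast this
  · ext y
    constructor
    · rintro ⟨x, ⟨hx, hxw⟩, rfl⟩
      refine ⟨(hg x hx).1, fun i => ?_⟩
      choose m hm using hx
      obtain rfl : x = fun i => t i + α * (m i : ℝ) := funext hm
      rw [hgm]
      rcases hxw i with h | h
      · left
        have : m i = n i := by
          rw [hn i] at h
          exact_mod_cast mul_left_cancel₀ hα.ne' (add_left_cancel h)
        simp only [this]
      · right
        have : m i = n i + e i := by
          have h' : α * (m i : ℝ) = α * ((n i + e i : ℤ) : ℝ) := by
            rw [hn i, hδe i] at h
            push_cast
            linarith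
          exact_mod_cast mul_left_cancel₀ hα.ne' h'
        simp only [this]
        push_cast
        ring
    · rintro ⟨-, hy⟩
      have hm : ∀ i, ∃ m : ℤ, (m = n i ∨ m = n i + e i) ∧
          y i = t i + α / 2 * ε i + 2 * α * (((m + s i) / 2 : ℤ) : ℝ) := by
        intro i
        rcases hy i with h | h
        · exact ⟨n i, .inl rfl, h⟩
        · refine ⟨n i + e i, .inr rfl, h.trans ?_⟩
          push_cast
          ring
      choose m hm hym using hm
      refine ⟨fun i => t i + α * (m i : ℝ), ⟨hmem m, fun i => ?_⟩, ?_⟩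
      · refine (hm i).imp (fun h => ?_) (fun h => ?_)
        · simp only [h, hn i]
        · simp only [h, hn i, hδe i]
          push_cast
          ring
      · rw [hgm, funext hym]
  · beta_reduce at hi
    have hi' : (n i + e i + s i) / 2 - (n i + s i) / 2 = 1 := by exact_mod_cast hi
    have : e i = 1 := by rcases he i with h | h <;> omega
    simp [hδe i, this]
end

section
/- Let w ∈ G, δ ∈ {0,1}^d, F = vert(w,δ), and let w' ∈ G', δ' ∈ {0,1}^d be such that g(F) = vert'(w',δ'). Then for every free direction i of the image face (δ'_i = 1): (a) δ_i = 1, and (b) the g-images of the two opposite facets of the face (w,δ) in direction i — namely g({x ∈ F : x_i = w_i}) and g({x ∈ F : x_i = w_i + α}) — are, in some order, exactly the vertex sets {y ∈ vert'(w',δ') : y_i = w'_i} and {y ∈ vert'(w',δ') : y_i = w'_i + 2α} of the two opposite facets of the image face in direction i. In particular, for any pair of opposite facets e₁, e₂ of the image face there exists a pair of opposite facets f₁, f₂ of (w,δ) with g(vert f₁) = vert e₁ and g(vert f₂) = vert e₂. -/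
/-- Two `G'`-coordinates within `α` of the same `G`-coordinate agree. -/
lemma grid'_coord_unique {α a e : ℝ} (hα : 0 < α) (he : e = 1 ∨ e = -1) (z m n : ℤ)
    (hm : |a + α * z - (a + α / 2 * e + 2 * α * m)| ≤ α)
    (hn : |a + α * z - (a + α / 2 * e + 2 * α * n)| ≤ α) : m = n := by
  have key : ∀ k : ℤ, |a + α * z - (a + α / 2 * e + 2 * α * k)| ≤ α →
      |2 * (z : ℝ) - e - 4 * k| ≤ 2 := by
    intro k hk
    rw [abs_le] at hk ⊢
    constructor <;> refine le_of_mul_le_mul_left ?_ hα <;> linarith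
  have h₁ := abs_le.mp (key m hm)
  have h₂ := abs_le.mp (key n hn)
  rcases he with rfl | rfl <;> norm_cast at h₁ h₂ <;> omega

/-- The `i`-th coordinate of `g x` depends only on the `i`-th coordinate of `x`. -/
lemma grid_map_coord_congr {d : ℕ} {α : ℝ} (hα : 0 < α) {t ε : Fin d → ℝ}
    (hε : ∀ i, ε i = 1 ∨ ε i = -1) {g : (Fin d → ℝ) → (Fin d → ℝ)}
    (hg : ∀ x ∈ grid d α t, g x ∈ grid' d α t ε ∧ ‖x - g x‖ ≤ α)
    {x y : Fin d → ℝ} (hx : x ∈ grid d α t) (hy : y ∈ grid d α t) {i : Fin d}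
    (hxy : x i = y i) : g x i = g y i := by
  obtain ⟨z, hz⟩ := hx i
  obtain ⟨m, hm⟩ := (hg x hx).1 i
  obtain ⟨n, hn⟩ := (hg y hy).1 i
  have h₁ : |x i - g x i| ≤ α := (norm_le_pi_norm (x - g x) i).trans (hg x hx).2
  have h₂ : |y i - g y i| ≤ α := (norm_le_pi_norm (y - g y) i).trans (hg y hy).2
  rw [hz, hm] at h₁
  rw [← hxy, hz, hn] at h₂
  rw [hm, hn, grid'_coord_unique hα (hε i) z m n h₁ h₂]

/-- A map of `F` onto `F'` that sends the slice `x i = a` into `y i = b` and the complementary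
slice `x i = a'` into `y i = b'`, where `b ≠ b'`, maps the first slice onto `y i = b`. -/
lemma image_slice_eq {ι : Type*} {g : (ι → ℝ) → (ι → ℝ)} {F F' : Set (ι → ℝ)}
    (him : g '' F = F') {i : ι} {a a' b b' : ℝ} (hb : b ≠ b')
    (hF : ∀ x ∈ F, x i = a ∨ x i = a')
    (ha : ∀ x ∈ F, x i = a → g x i = b) (ha' : ∀ x ∈ F, x i = a' → g x i = b') :
    g '' {x ∈ F | x i = a} = {y ∈ F' | y i = b} := by
  subst him
  ext y
  constructor
  · rintro ⟨x, ⟨hx, hxa⟩, rfl⟩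
    exact ⟨⟨x, hx, rfl⟩, ha x hx hxa⟩
  · rintro ⟨⟨x, hx, rfl⟩, hxb⟩
    refine ⟨x, ⟨hx, (hF x hx).resolve_right fun h => hb ?_⟩, rfl⟩
    rw [← hxb, ha' x hx h]

/-- Suppose the grid map `g : G → G'` (sending `x ∈ G` to the unique
`y ∈ G'` with `‖x − y‖_∞ ≤ α`; the sup-norm `‖·‖` on `Fin d → ℝ` is the
`L∞`-norm) maps the vertex set of the face `(w,δ)` of `G` onto the vertex
set of the face `(w',δ')` of `G'`. Then for every free direction `i` of
the image face (`δ'_i = 1`): (a) `δ_i = 1`, and (b) the `g`-images of the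
two opposite facets of `(w,δ)` in direction `i` are, in some order,
exactly the vertex sets of the two opposite facets of the image face in
direction `i`. -/
theorem stmt8 (d : ℕ) (hd : 1 ≤ d) (α : ℝ) (hα : 0 < α) (t ε : Fin d → ℝ)
    (hε : ∀ i, ε i = 1 ∨ ε i = -1)
    (g : (Fin d → ℝ) → (Fin d → ℝ))
    (hg : ∀ x ∈ grid d α t, g x ∈ grid' d α t ε ∧ ‖x - g x‖ ≤ α)
    (w : Fin d → ℝ) (hw : w ∈ grid d α t)
    (δ : Fin d → ℝ) (hδ : ∀ i, δ i = 0 ∨ δ i = 1)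
    (w' : Fin d → ℝ) (hw' : w' ∈ grid' d α t ε)
    (δ' : Fin d → ℝ) (hδ' : ∀ i, δ' i = 0 ∨ δ' i = 1)
    (him : g '' vert d α t w δ = vert' d α t ε w' δ') :
    ∀ i, δ' i = 1 →
      δ i = 1 ∧
      ((g '' {x ∈ vert d α t w δ | x i = w i} =
          {y ∈ vert' d α t ε w' δ' | y i = w' i} ∧
        g '' {x ∈ vert d α t w δ | x i = w i + α} =
          {y ∈ vert' d α t ε w' δ' | y i = w' i + 2 * α}) ∨
       (g '' {x ∈ vert d α t w δ | x i = w i} =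
          {y ∈ vert' d α t ε w' δ' | y i = w' i + 2 * α} ∧
        g '' {x ∈ vert d α t w δ | x i = w i + α} =
          {y ∈ vert' d α t ε w' δ' | y i = w' i})) := by
  intro i hi
  have hne : w' i ≠ w' i + 2 * α := by linarith
  have hlow : w' ∈ vert' d α t ε w' δ' := ⟨hw', fun _ => Or.inl rfl⟩
  have hup : Function.update w' i (w' i + 2 * α) ∈ vert' d α t ε w' δ' := by
    refine ⟨fun j => ?_, fun j => ?_⟩
    · rcases eq_or_ne j i with rfl | hj
      · obtain ⟨z, hz⟩ := hw' j
        refine ⟨z + 1, ?_⟩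
        rw [Function.update_self, hz]
        push_cast
        ring
      · rw [Function.update_of_ne hj]
        exact hw' j
    · rcases eq_or_ne j i with rfl | hj
      · right
        rw [Function.update_self, hi, one_mul]
      · left
        rw [Function.update_of_ne hj]
  rw [← him] at hlow hup
  obtain ⟨x₀, hx₀, hgx₀⟩ := hlow
  obtain ⟨x₁, hx₁, hgx₁⟩ := hup
  have hg₀ : g x₀ i = w' i := by rw [hgx₀]
  have hg₁ : g x₁ i = w' i + 2 * α := by rw [hgx₁, Function.update_self]
  have hx_ne : x₀ i ≠ x₁ i := fun h => hne <| by
    rw [← hg₁, ← hg₀, grid_map_coord_congr hα hε hg hx₀.1 hx₁.1 h]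
  have hδi : δ i = 1 := by
    refine (hδ i).resolve_left fun h => hx_ne ?_
    have h₀ := hx₀.2 i
    have h₁ := hx₁.2 i
    simp only [h, zero_mul, add_zero, or_self] at h₀ h₁
    rw [h₀, h₁]
  have hF : ∀ x ∈ vert d α t w δ, x i = w i ∨ x i = w i + α := fun x hx => by
    simpa [hδi] using hx.2 i
  have hc₀ : ∀ x ∈ vert d α t w δ, x i = x₀ i → g x i = w' i := fun x hx h =>
    (grid_map_coord_congr hα hε hg hx.1 hx₀.1 h).trans hg₀
  have hc₁ : ∀ x ∈ vert d α t w δ, x i = x₁ i → g x i = w' i + 2 * α := fun x hx h =>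
    (grid_map_coord_congr hα hε hg hx.1 hx₁.1 h).trans hg₁
  refine ⟨hδi, ?_⟩
  rcases hF x₀ hx₀ with h₀ | h₀ <;> rcases hF x₁ hx₁ with h₁ | h₁
  · exact absurd (h₀.trans h₁.symm) hx_ne
  · rw [h₀] at hc₀
    rw [h₁] at hc₁
    exact Or.inl ⟨image_slice_eq him hne hF hc₀ hc₁,
      image_slice_eq him hne.symm (fun x hx => (hF x hx).symm) hc₁ hc₀⟩
  · rw [h₀] at hc₀
    rw [h₁] at hc₁
    exact Or.inr ⟨image_slice_eq him hne.symm hF hc₁ hc₀,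
      image_slice_eq him hne (fun x hx => (hF x hx).symm) hc₀ hc₁⟩
  · exact absurd (h₀.trans h₁.symm) hx_ne
end

section
/- Let P ⊆ ℝ^d be finite and nonempty, and suppose every p ∈ P has a unique nearest point a(p) ∈ G (equivalently ‖p − a(p)‖_∞ < α/2) and a unique nearest point a'(p) ∈ G' (equivalently ‖p − a'(p)‖_∞ < α). Set V = a(P) ⊆ G (the active vertices of G) and V' = a'(P) ⊆ G' (the active vertices of G'). If a face (w,δ) of the cubical complex on G is spanned by V, then the face of the cubical complex on G' whose vertex set is g(vert(w,δ)) is spanned by V'. (Active faces map to active faces under g.) -/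
/-- The face `(w,δ)` of the cubical complex on `G` is spanned by `V`:
`vert(w,δ) ∩ V` is nonempty, and for every free direction `i` (`δ_i = 1`)
there are points of `vert(w,δ) ∩ V` on both opposite facets in direction
`i`. -/
def spans (d : ℕ) (α : ℝ) (t : Fin d → ℝ) (w δ : Fin d → ℝ)
    (V : Set (Fin d → ℝ)) : Prop :=
  (vert d α t w δ ∩ V).Nonempty ∧
  ∀ i, δ i = 1 →
    (∃ u ∈ vert d α t w δ ∩ V, u i = w i) ∧
    (∃ v ∈ vert d α t w δ ∩ V, v i = w i + α)

/-- The face `(w',δ')` of the cubical complex on `G'` is spanned by `V'`. -/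
def spans' (d : ℕ) (α : ℝ) (t ε : Fin d → ℝ) (w' δ' : Fin d → ℝ)
    (V' : Set (Fin d → ℝ)) : Prop :=
  (vert' d α t ε w' δ' ∩ V').Nonempty ∧
  ∀ i, δ' i = 1 →
    (∃ u ∈ vert' d α t ε w' δ' ∩ V', u i = w' i) ∧
    (∃ v ∈ vert' d α t ε w' δ' ∩ V', v i = w' i + 2 * α)

/-- A point of a one-dimensional lattice of step `α` within `3α/2` of a point of the shifted
lattice of step `2α` is one of the two lattice points adjacent to it. -/
lemma index_of_abs_sub_lt {α t e : ℝ} (hα : 0 < α) (he : e = 1 ∨ e = -1) {m k : ℤ}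
    (h : |t + α * m - (t + α / 2 * e + 2 * α * k)| < 3 * α / 2) :
    (e = 1 ∧ (m = 2 * k ∨ m = 2 * k + 1)) ∨ (e = -1 ∧ (m = 2 * k ∨ m = 2 * k - 1)) := by
  have hfac : t + α * m - (t + α / 2 * e + 2 * α * k) = α * (m - e / 2 - 2 * k) := by ring
  rw [hfac, abs_mul, abs_of_pos hα, show 3 * α / 2 = α * (3 / 2) by ring,
    mul_lt_mul_iff_right₀ hα, abs_lt] at h
  obtain ⟨h₁, h₂⟩ := h
  rcases he with rfl | rfl
  · have h₃ : -1 < m - 2 * k := by exact_mod_cast (by linarith : (-1 : ℝ) < m - 2 * k)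
    have h₄ : m - 2 * k < 2 := by exact_mod_cast (by linarith : (m - 2 * k : ℝ) < 2)
    exact Or.inl ⟨rfl, by omega⟩
  · have h₃ : -2 < m - 2 * k := by exact_mod_cast (by linarith : (-2 : ℝ) < m - 2 * k)
    have h₄ : m - 2 * k < 1 := by exact_mod_cast (by linarith : (m - 2 * k : ℝ) < 1)
    exact Or.inr ⟨rfl, by omega⟩

lemma grid'_coord_eq_of_near {d : ℕ} {α : ℝ} (hα : 0 < α) {t ε : Fin d → ℝ} {i : Fin d}
    (hε : ε i = 1 ∨ ε i = -1) {x x' y y' : Fin d → ℝ} (hx : x ∈ grid d α t)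
    (hy : y ∈ grid' d α t ε) (hy' : y' ∈ grid' d α t ε) (hxx : x' i = x i)
    (h : |x i - y i| < 3 * α / 2) (h' : |x' i - y' i| < 3 * α / 2) : y' i = y i := by
  obtain ⟨m, hm⟩ := hx i
  obtain ⟨k, hk⟩ := hy i
  obtain ⟨k', hk'⟩ := hy' i
  rw [hm, hk] at h
  rw [hxx, hm, hk'] at h'
  have hkk : k' = k := by
    have := index_of_abs_sub_lt hα hε h
    have := index_of_abs_sub_lt hα hε h'
    rcases hε with he | he <;> norm_num [he] at * <;> omega
  rw [hk, hk', hkk]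

lemma grid'_coord_step_of_near {d : ℕ} {α : ℝ} (hα : 0 < α) {t ε : Fin d → ℝ} {i : Fin d}
    (hε : ε i = 1 ∨ ε i = -1) {x x' y y' : Fin d → ℝ} (hx : x ∈ grid d α t)
    (hy : y ∈ grid' d α t ε) (hy' : y' ∈ grid' d α t ε) (hxx : x' i = x i + α)
    (h : |x i - y i| < 3 * α / 2) (h' : |x' i - y' i| < 3 * α / 2) :
    y' i = y i ∨ y' i = y i + 2 * α := by
  obtain ⟨m, hm⟩ := hx i
  obtain ⟨k, hk⟩ := hy i
  obtain ⟨k', hk'⟩ := hy' i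
  rw [hm, hk] at h
  rw [hxx, hm, hk', show t i + α * m + α = t i + α * ((m + 1 : ℤ) : ℝ) by push_cast; ring] at h'
  have hkk : k' = k ∨ k' = k + 1 := by
    have := index_of_abs_sub_lt hα hε h
    have := index_of_abs_sub_lt hα hε h'
    rcases hε with he | he <;> norm_num [he] at * <;> omega
  rcases hkk with rfl | rfl
  · exact Or.inl (hk'.trans hk.symm)
  · right
    rw [hk, hk']
    push_cast
    ring

/-- Active faces map to active faces: let `P` be a finite nonempty point
set such that every `p ∈ P` has a unique nearest point `a p ∈ G`
(equivalently `‖p − a p‖_∞ < α/2`; the sup-norm `‖·‖` on `Fin d → ℝ` is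
the `L∞`-norm) and a unique nearest point `a' p ∈ G'` (equivalently
`‖p − a' p‖_∞ < α`), and let `g : G → G'` map `x ∈ G` to the unique point
of `G'` at `L∞`-distance at most `α`. If the face `(w,δ)` of `G` is
spanned by the active vertices `V = a(P)`, then the face of `G'` whose
vertex set is `g(vert(w,δ))` is spanned by the active vertices
`V' = a'(P)`. -/
theorem stmt9 (d : ℕ) (hd : 1 ≤ d) (α : ℝ) (hα : 0 < α) (t ε : Fin d → ℝ)
    (hε : ∀ i, ε i = 1 ∨ ε i = -1)
    (g : (Fin d → ℝ) → (Fin d → ℝ))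
    (hg : ∀ x ∈ grid d α t, g x ∈ grid' d α t ε ∧ ‖x - g x‖ ≤ α)
    (P : Finset (Fin d → ℝ)) (hPne : P.Nonempty)
    (a a' : (Fin d → ℝ) → (Fin d → ℝ))
    (ha : ∀ p ∈ P, a p ∈ grid d α t ∧ ‖p - a p‖ < α / 2)
    (ha' : ∀ p ∈ P, a' p ∈ grid' d α t ε ∧ ‖p - a' p‖ < α)
    (w : Fin d → ℝ) (hw : w ∈ grid d α t)
    (δ : Fin d → ℝ) (hδ : ∀ i, δ i = 0 ∨ δ i = 1)
    (hspan : spans d α t w δ (a '' (P : Set (Fin d → ℝ)))) :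
    ∃ w' δ' : Fin d → ℝ, w' ∈ grid' d α t ε ∧
      (∀ i, δ' i = 0 ∨ δ' i = 1) ∧
      g '' vert d α t w δ = vert' d α t ε w' δ' ∧
      spans' d α t ε w' δ' (a' '' (P : Set (Fin d → ℝ))) := by
  have hnear : ∀ x ∈ grid d α t, ∀ i, |x i - g x i| < 3 * α / 2 := fun x hx i =>
    ((norm_le_pi_norm (x - g x) i).trans (hg x hx).2).trans_lt (by linarith)
  have hloc : ∀ x ∈ grid d α t, ∀ x' ∈ grid d α t, ∀ i, x' i = x i → g x' i = g x i :=
    fun x hx x' hx' i h => grid'_coord_eq_of_near hα (hε i) hx (hg x hx).1 (hg x' hx').1 h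
      (hnear x hx i) (hnear x' hx' i)
  have hga : ∀ p ∈ P, a' p = g (a p) := by
    intro p hp
    obtain ⟨hap, hpa⟩ := ha p hp
    obtain ⟨hap', hpa'⟩ := ha' p hp
    ext i
    refine grid'_coord_eq_of_near hα (hε i) hap (hg _ hap).1 hap' rfl (hnear _ hap i) ?_
    have h₁ : |p i - a p i| < α / 2 := (norm_le_pi_norm (p - a p) i).trans_lt hpa
    have h₂ : |p i - a' p i| < α := (norm_le_pi_norm (p - a' p) i).trans_lt hpa'
    rw [abs_lt] at h₁ h₂ ⊢
    constructor <;> linarith [h₁.1, h₁.2, h₂.1, h₂.2]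
  obtain ⟨v, hv⟩ : ∃ v : Fin d → ℝ, ∀ i, v i = w i + δ i * α := ⟨_, fun _ => rfl⟩
  have hvG : v ∈ grid d α t := by
    intro i
    obtain ⟨m, hm⟩ := hw i
    rcases hδ i with h | h
    · exact ⟨m, by rw [hv, h, hm]; ring⟩
    · exact ⟨m + 1, by rw [hv, h, hm]; push_cast; ring⟩
  obtain ⟨δ', hδ'⟩ : ∃ δ' : Fin d → ℝ, ∀ i, g v i = g w i + δ' i * (2 * α) :=
    ⟨fun i => (g v i - g w i) / (2 * α), fun i => by field_simp; ring⟩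
  have hδ'0 : ∀ i, g v i = g w i → δ' i = 0 := by
    intro i h
    have := hδ' i
    rw [h, left_eq_add] at this
    exact (mul_eq_zero.1 this).resolve_right (by positivity)
  have himage : g '' vert d α t w δ = vert' d α t ε (g w) δ' := by
    ext y
    constructor
    · rintro ⟨x, ⟨hx, hxw⟩, rfl⟩
      refine ⟨(hg x hx).1, fun i => (hxw i).imp (hloc w hw x hx i) fun h => ?_⟩
      rw [← hδ', hloc v hvG x hx i (h.trans (hv i).symm)]
    · rintro ⟨-, hyw⟩
      classical
      let x : Fin d → ℝ := fun i => if y i = g w i then w i else v i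
      have hx : x ∈ grid d α t := by
        intro i
        by_cases h : y i = g w i
        · simpa [x, h] using hw i
        · simpa [x, h] using hvG i
      refine ⟨x, ⟨hx, fun i => ?_⟩, ?_⟩
      · by_cases h : y i = g w i <;> simp [x, h, hv]
      · ext i
        by_cases h : y i = g w i
        · rw [h, hloc w hw x hx i (by simp [x, h])]
        · rw [(hyw i).resolve_left h, ← hδ', hloc v hvG x hx i (by simp [x, h])]
  have hactive : ∀ x ∈ vert d α t w δ ∩ a '' (P : Set (Fin d → ℝ)),
      g x ∈ vert' d α t ε (g w) δ' ∩ a' '' (P : Set (Fin d → ℝ)) := by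
    rintro _ ⟨hx, p, hp, rfl⟩
    exact ⟨himage ▸ Set.mem_image_of_mem g hx, p, hp, hga p hp⟩
  refine ⟨g w, δ', (hg w hw).1, fun i => ?_, himage,
    hspan.1.elim fun x hx => ⟨g x, hactive x hx⟩, fun i hi => ?_⟩
  · rcases hδ i with h | h
    · exact Or.inl (hδ'0 i (hloc w hw v hvG i (by simp [hv, h])))
    · refine (grid'_coord_step_of_near hα (hε i) hw (hg w hw).1 (hg v hvG).1
        (by simp [hv, h]) (hnear w hw i) (hnear v hvG i)).imp (hδ'0 i) fun h' => ?_
      have := hδ' i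
      rw [h', add_right_inj] at this
      exact (mul_eq_right₀ (by positivity)).1 this.symm
  · have hδi : δ i = 1 := by
      refine (hδ i).resolve_left fun h => ?_
      have := hδ'0 i (hloc w hw v hvG i (by simp [hv, h]))
      linarith
    obtain ⟨⟨x, hx, hxi⟩, ⟨z, hz, hzi⟩⟩ := hspan.2 i hδi
    refine ⟨⟨g x, hactive x hx, hloc w hw x hx.1.1 i hxi⟩, ⟨g z, hactive z hz, ?_⟩⟩
    rw [hloc v hvG z hz.1.1 i (by rw [hzi, hv, hδi, one_mul]), hδ', hi, one_mul]
end

section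
/- Let d ≥ 1 and k ≥ 0 be integers. Consider the face poset of the d-dimensional cube [0,1]^d: its elements are pairs (a,b) with a, b ∈ {0,1}^d and a_i ≤ b_i for all i (representing the box ∏_i [a_i, b_i]), ordered by box containment, i.e., (a,b) ≤ (a',b') iff a'_i ≤ a_i and b_i ≤ b'_i for all i. Then the number of strictly increasing chains f₀ < f₁ < ⋯ < f_k in this poset is at most (2k+3)^d. -/
/-- The sum of all endpoints of a sequence of `k + 1` faces of `[0,1]` is at most `2k + 2`. -/
theorem endpointSum_lt {k : ℕ} (a b : Fin (k + 1) → Fin 2) :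
    ∑ j, ((a j : ℕ) + (b j : ℕ)) < 2 * k + 3 := by
  have h : ∑ j, ((a j : ℕ) + (b j : ℕ)) ≤ ∑ _j : Fin (k + 1), 2 :=
    Finset.sum_le_sum fun j _ => by omega
  simp only [Finset.sum_const, Finset.card_univ, Fintype.card_fin, smul_eq_mul] at h
  omega

/-- Two weakly increasing sequences of faces of `[0,1]` are comparable
for the pointwise order on endpoints. -/
theorem endpoints_le_total {k : ℕ} {a b a' b' : Fin (k + 1) → Fin 2}
    (ha : Antitone a) (hb : Monotone b) (hab : ∀ j, a j ≤ b j)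
    (ha' : Antitone a') (hb' : Monotone b') (hab' : ∀ j, a' j ≤ b' j) :
    (∀ j, a j ≤ a' j ∧ b j ≤ b' j) ∨ (∀ j, a' j ≤ a j ∧ b' j ≤ b j) := by
  by_contra! h
  obtain ⟨⟨j, hj⟩, ⟨l, hl⟩⟩ := h
  have h₁ := ha (Fin.zero_le j)
  have h₂ := ha' (Fin.zero_le j)
  have h₃ := hb (Fin.zero_le j)
  have h₄ := hb' (Fin.zero_le j)
  have h₅ := ha (Fin.zero_le l)
  have h₆ := ha' (Fin.zero_le l)
  have h₇ := hb (Fin.zero_le l)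
  have h₈ := hb' (Fin.zero_le l)
  have h₉ := hab 0
  have h₁₀ := hab' 0
  rcases le_total j l with hjl | hjl <;>
    have g₁ := ha hjl <;> have g₂ := ha' hjl <;> have g₃ := hb hjl <;> have g₄ := hb' hjl <;>
    by_cases hja : a j ≤ a' j <;> by_cases hla : a' l ≤ a l <;>
    simp only [hja, hla, forall_true_left] at hj hl <;> omega

/-- A weakly increasing sequence of faces of `[0,1]` is determined by the sum of its endpoints. -/
theorem endpointSum_injective {k : ℕ} {a b a' b' : Fin (k + 1) → Fin 2}
    (ha : Antitone a) (hb : Monotone b) (hab : ∀ j, a j ≤ b j)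
    (ha' : Antitone a') (hb' : Monotone b') (hab' : ∀ j, a' j ≤ b' j)
    (h : ∑ j, ((a j : ℕ) + (b j : ℕ)) = ∑ j, ((a' j : ℕ) + (b' j : ℕ))) :
    a = a' ∧ b = b' := by
  wlog hle : ∀ j, a j ≤ a' j ∧ b j ≤ b' j generalizing a b a' b'
  · have := this ha' hb' hab' ha hb hab h.symm
      ((endpoints_le_total ha hb hab ha' hb' hab').resolve_left hle)
    exact ⟨this.1.symm, this.2.symm⟩
  have heq := (Finset.sum_eq_sum_iff_of_le fun j _ =>
    Nat.add_le_add (Fin.le_def.mp (hle j).1) (Fin.le_def.mp (hle j).2)).mp h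
  constructor <;> funext j <;> have h₁ := hle j <;> have h₂ := heq j (Finset.mem_univ j) <;> omega


/-- The face poset of the `d`-cube `[0,1]^d`: elements are pairs `(a,b)`
with `a, b ∈ {0,1}^d`, `a_i ≤ b_i` for all `i` (representing the box
`∏ [a_i, b_i]`). -/
abbrev CubeFace (d : ℕ) : Type :=
  {f : (Fin d → Fin 2) × (Fin d → Fin 2) // ∀ i, f.1 i ≤ f.2 i}

/-- Containment order on faces of the cube:
`(a,b) ≤ (a',b')` iff `a'_i ≤ a_i` and `b_i ≤ b'_i` for all `i`. -/
def faceLE {d : ℕ} (f f' : CubeFace d) : Prop :=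
  ∀ i, f'.1.1 i ≤ f.1.1 i ∧ f.1.2 i ≤ f'.1.2 i

/-- Strict containment of faces of the cube. -/
def faceLT {d : ℕ} (f f' : CubeFace d) : Prop :=
  faceLE f f' ∧ f ≠ f'

/-- The number of strictly increasing chains `f₀ < f₁ < ⋯ < f_k` in the
face poset of the `d`-dimensional cube is at most `(2k+3)^d`. -/
theorem stmt11 (d k : ℕ) (hd : 1 ≤ d) :
    Nat.card {c : Fin (k + 1) → CubeFace d //
        ∀ i j : Fin (k + 1), i < j → faceLT (c i) (c j)} ≤
      (2 * k + 3) ^ d := by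
  let code : {c : Fin (k + 1) → CubeFace d //
      ∀ i j : Fin (k + 1), i < j → faceLT (c i) (c j)} → (Fin d → Fin (2 * k + 3)) :=
    fun c i => ⟨_, endpointSum_lt (fun j => (c.1 j).1.1 i) (fun j => (c.1 j).1.2 i)⟩
  have anti (c : {c : Fin (k + 1) → CubeFace d //
      ∀ i j : Fin (k + 1), i < j → faceLT (c i) (c j)}) (i : Fin d) :
      Antitone (fun j => (c.1 j).1.1 i) ∧ Monotone (fun j => (c.1 j).1.2 i) := by
    constructor <;> intro j l hjl <;> rcases hjl.eq_or_lt with rfl | h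
    · exact le_rfl
    · exact ((c.2 j l h).1 i).1
    · exact le_rfl
    · exact ((c.2 j l h).1 i).2
  have hcode : Function.Injective code := by
    intro c c' h
    have key (i : Fin d) := endpointSum_injective (anti c i).1 (anti c i).2
      (fun j => (c.1 j).2 i) (anti c' i).1 (anti c' i).2 (fun j => (c'.1 j).2 i)
      (congrArg Fin.val (congrFun h i))
    apply Subtype.ext
    funext j
    apply Subtype.ext
    exact Prod.ext (funext fun i => congrFun (key i).1 j) (funext fun i => congrFun (key i).2 j)
  simpa using Nat.card_le_card_of_injective code hcode
end
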